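/- arXiv:2311.16977 — 5 statements merged into one kernel-verified Lean document; each statement's English description precedes it below -/
import Mathlib

section
/- Let L be a complete lattice, ι a nonempty index set, and (f_i)_{i∈ι} a family of monotone inflationary functions f_i : L → L (x ≤ f_i x for all x and i). For each i and s ∈ L let F_i(s) denote the least fixed point of f_i that is greater than or equal to s. Then for every s ∈ L, the least fixed point of x ↦ ⨆_{i∈ι} f_i(x) above s and the least fixed point of x ↦ ⨆_{i∈ι} F_i(x) above s both exist and are equal. -/
/-- Let `L` be a complete lattice, `ι` a nonempty index set, and `(f i)` a
family of monotone inflationary functions; let `F i s` be the least fixed point of `f i`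
above `s`. Then for every `s`, the least fixed point of `x ↦ ⨆ i, f i x` above `s` and the
least fixed point of `x ↦ ⨆ i, F i x` above `s` both exist and are equal. -/
theorem stmt3 {L : Type*} [CompleteLattice L] {ι : Type*} [Nonempty ι]
    (f : ι → L → L) (hmono : ∀ i, Monotone (f i)) (hinfl : ∀ i (x : L), x ≤ f i x)
    (F : ι → L → L) (hF : ∀ i (s : L), IsLeast {x : L | f i x = x ∧ s ≤ x} (F i s)) :
    ∀ s : L, ∃ a : L,
      IsLeast {x : L | (⨆ i, f i x) = x ∧ s ≤ x} a ∧
      IsLeast {x : L | (⨆ i, F i x) = x ∧ s ≤ x} a := by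
  intro s
  have h1 : ∀ x : L, (⨆ i, f i x) = x ↔ ∀ i, f i x = x := by
    intro x
    constructor
    · intro h i
      exact le_antisymm ((le_iSup (fun i => f i x) i).trans h.le) (hinfl i x)
    · intro h
      simp [h]
  have h2 : ∀ x : L, (⨆ i, F i x) = x ↔ ∀ i, f i x = x := by
    intro x
    constructor
    · intro h i
      have e : F i x = x :=
        le_antisymm ((le_iSup (fun i => F i x) i).trans h.le) (hF i x).1.2
      have e2 := (hF i x).1.1
      rwa [e] at e2
    · intro h
      have e : ∀ i, F i x = x := fun i =>
        le_antisymm ((hF i x).2 ⟨h i, le_rfl⟩) (hF i x).1.2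
      simp [e]
  simp only [h1, h2, and_self]
  refine ⟨sInf {x : L | (∀ i, f i x = x) ∧ s ≤ x}, ⟨?_, ?_⟩, ?_⟩
  · intro i
    refine le_antisymm (le_sInf ?_) (hinfl i _)
    intro x hx
    exact (hmono i (sInf_le hx)).trans (hx.1 i).le
  · exact le_sInf fun x hx => hx.2
  · intro x hx
    exact sInf_le hx
end

section
/- Let L be a complete lattice. Let Seq(L) be the set of functions f : ℕ → Option L whose domain is an initial segment (for all m ≤ n, if f n ≠ none then f m ≠ none), ordered by: f ≤ g if and only if for every n and every a, f n = some a implies there exists b with g n = some b and a ≤ b. Then Seq(L) is a complete lattice whose least element is the constant-none function ε and whose greatest element is the everywhere-defined function constantly equal to the top element of L. -/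
/-- Finite and infinite traces over `L`: functions `ℕ → Option L` whose domain is an
initial segment. -/
def SeqL (L : Type*) : Type _ :=
  {f : ℕ → Option L // ∀ m n : ℕ, m ≤ n → f n ≠ none → f m ≠ none}

/-- The trace order: `f ≤ g` iff for every `n`, whenever `f n = some a` there exists `b`
with `g n = some b` and `a ≤ b`. -/
def SeqLe {L : Type*} [CompleteLattice L] (f g : SeqL L) : Prop :=
  ∀ (n : ℕ) (a : L), f.1 n = some a → ∃ b : L, g.1 n = some b ∧ a ≤ b

/-- The empty trace `ε`. -/
def seqEps (L : Type*) : SeqL L :=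
  ⟨fun _ => none, fun _ _ _ h => absurd rfl h⟩

/-- The everywhere-defined trace constantly equal to the top element of `L`. -/
def seqTop (L : Type*) [CompleteLattice L] : SeqL L :=
  ⟨fun _ => some ⊤, fun _ _ _ _ => by simp⟩

theorem seqLe_antisymm {L : Type*} [CompleteLattice L] (f g : SeqL L)
    (h1 : SeqLe f g) (h2 : SeqLe g f) : f = g := by
  apply Subtype.ext
  funext n
  cases hf : f.1 n with
  | none =>
    cases hg : g.1 n with
    | none => rfl
    | some b =>
      obtain ⟨c, hc, _⟩ := h2 n b hg
      rw [hf] at hc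
      cases hc
  | some a =>
    obtain ⟨b, hb, hab⟩ := h1 n a hf
    obtain ⟨c, hc, hbc⟩ := h2 n b hb
    rw [hf] at hc
    cases hc
    rw [hb, le_antisymm hab hbc]

open Classical in
noncomputable def seqSup {L : Type*} [CompleteLattice L] (S : Set (SeqL L)) : SeqL L :=
  ⟨fun n => if ∃ f ∈ S, f.1 n ≠ none then some (sSup {a | ∃ f ∈ S, f.1 n = some a}) else none, by
    intro m n hmn h
    by_cases hn : ∃ f ∈ S, f.1 n ≠ none
    · obtain ⟨f, hf, hfn⟩ := hn
      have hm : ∃ f ∈ S, f.1 m ≠ none := ⟨f, hf, f.2 m n hmn hfn⟩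
      exact fun h0 => Option.some_ne_none _ ((if_pos hm).symm.trans h0)
    · exact absurd (if_neg hn) h⟩

theorem le_seqSup {L : Type*} [CompleteLattice L] (S : Set (SeqL L)) (f : SeqL L)
    (hf : f ∈ S) : SeqLe f (seqSup S) := by
  intro n a ha
  refine ⟨sSup {a | ∃ f ∈ S, f.1 n = some a}, ?_, le_sSup ⟨f, hf, ha⟩⟩
  exact if_pos ⟨f, hf, by rw [ha]; simp⟩

theorem seqSup_le {L : Type*} [CompleteLattice L] (S : Set (SeqL L)) (g : SeqL L)
    (hg : ∀ f ∈ S, SeqLe f g) : SeqLe (seqSup S) g := by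
  intro n a ha
  by_cases hn : ∃ f ∈ S, f.1 n ≠ none
  · have h2 : (seqSup S).1 n = some (sSup {a | ∃ f ∈ S, f.1 n = some a}) := if_pos hn
    rw [h2] at ha
    cases ha
    obtain ⟨f, hf, hfn⟩ := hn
    obtain ⟨c, hc⟩ := Option.ne_none_iff_exists'.mp hfn
    obtain ⟨b, hb, _⟩ := hg f hf n c hc
    refine ⟨b, hb, sSup_le ?_⟩
    rintro x ⟨k, hk, hkx⟩
    obtain ⟨b', hb', hx⟩ := hg k hk n x hkx
    rw [hb] at hb'
    cases hb'
    exact hx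
  · have h2 : (seqSup S).1 n = none := if_neg hn
    rw [h2] at ha
    cases ha

/-- For a complete lattice `L`, the set of traces `SeqL L` with the
order `SeqLe` is a complete lattice whose least element is the empty trace `ε` and whose
greatest element is the everywhere-defined trace constantly equal to `⊤`. -/
theorem stmt8 {L : Type*} [CompleteLattice L] :
    ∃ inst : CompleteLattice (SeqL L),
      (∀ f g : SeqL L, inst.le f g ↔ SeqLe f g) ∧
      inst.bot = seqEps L ∧
      inst.top = seqTop L := by
  letI po : PartialOrder (SeqL L) :=
    { le := SeqLe
      le_refl := fun f n a h => ⟨a, h, le_rfl⟩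
      le_trans := fun f g k h1 h2 n a h => by
        obtain ⟨b, hb, hab⟩ := h1 n a h
        obtain ⟨c, hc, hbc⟩ := h2 n b hb
        exact ⟨c, hc, hab.trans hbc⟩
      le_antisymm := seqLe_antisymm }
  letI ss : SupSet (SeqL L) := ⟨seqSup⟩
  letI inst : CompleteLattice (SeqL L) := completeLatticeOfSup (SeqL L)
    (fun S => ⟨fun f hf => le_seqSup S f hf, fun g hg => seqSup_le S g (fun f hf => hg hf)⟩)
  refine ⟨inst, fun f g => Iff.rfl, ?_, ?_⟩
  · refine seqLe_antisymm _ _ (inst.bot_le (seqEps L)) ?_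
    intro n a h
    cases h
  · refine seqLe_antisymm _ _ ?_ (inst.le_top (seqTop L))
    intro n a h
    exact ⟨⊤, rfl, le_top⟩
end

section
/- Define mergeK : List Bool → List T → List T → List T by: mergeK [] t f = [], mergeK (true :: b) [] f = [], mergeK (true :: b) (x :: t) f = x :: mergeK b t f, mergeK (false :: b) t [] = [], and mergeK (false :: b) t (y :: f) = y :: mergeK b t f. If b is a prefix of b', t is a prefix of t', and f is a prefix of f' (List.IsPrefix), then mergeK b t f is a prefix of mergeK b' t' f'. -/
/-- Finite-stream Kahn transformer for the deterministic multiplexer `merge b t f`. -/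
def mergeK {T : Type*} : List Bool → List T → List T → List T
  | [], _, _ => []
  | true :: _, [], _ => []
  | true :: b, x :: t, f => x :: mergeK b t f
  | false :: _, _, [] => []
  | false :: b, t, y :: f => y :: mergeK b t f

/-- `mergeK` is monotone with respect to the prefix order. -/
theorem stmt11 {T : Type*} (b b' : List Bool) (t t' f f' : List T)
    (hb : b <+: b') (ht : t <+: t') (hf : f <+: f') :
    mergeK b t f <+: mergeK b' t' f' := by
  induction b generalizing b' t t' f f' with
  | nil => simp [mergeK]
  | cons c b ih =>
    obtain ⟨s, rfl⟩ := hb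
    cases c with
    | true =>
      cases t with
      | nil => simp [mergeK]
      | cons x t =>
        obtain ⟨u, rfl⟩ := ht
        simp only [List.cons_append, mergeK, List.cons_prefix_cons, true_and]
        exact ih _ _ _ _ _ (List.prefix_append _ _) (List.prefix_append _ _) hf
    | false =>
      cases f with
      | nil => simp [mergeK]
      | cons y f =>
        obtain ⟨u, rfl⟩ := hf
        simp only [List.cons_append, mergeK, List.cons_prefix_cons, true_and]
        exact ih _ _ _ _ _ (List.prefix_append _ _) ht (List.prefix_append _ _)
end

section
/- Let T be a type, i : ℕ → T, and bp : ℕ → Bool such that for every n there exists m ≥ n with bp m = true (bp is 'always eventually' true). Then there exists exactly one function o : ℕ → T satisfying, for every n, o n = (if bp n = true then i n else o (n + 1)); moreover this unique solution is given by o n = i m(n), where m(n) is the least m ≥ n with bp m = true. -/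
/-- If `bp` is always eventually true, then there is exactly one function
`o` satisfying the backfill equation `o n = if bp n then i n else o (n+1)`; moreover the
unique solution satisfies `o n = i m` where `m` is the least index `m ≥ n` with `bp m = true`. -/
theorem stmt15 {T : Type*} (i : ℕ → T) (bp : ℕ → Bool)
    (hbp : ∀ n : ℕ, ∃ m : ℕ, n ≤ m ∧ bp m = true) :
    (∃! o : ℕ → T, ∀ n : ℕ, o n = if bp n = true then i n else o (n + 1)) ∧
    (∀ o : ℕ → T, (∀ n : ℕ, o n = if bp n = true then i n else o (n + 1)) →
      ∀ n m : ℕ, IsLeast {k : ℕ | n ≤ k ∧ bp k = true} m → o n = i m) := by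
  have key : ∀ o : ℕ → T, (∀ n : ℕ, o n = if bp n = true then i n else o (n + 1)) →
      ∀ n m : ℕ, IsLeast {k : ℕ | n ≤ k ∧ bp k = true} m → o n = i m := by
    intro o ho n m hm
    obtain ⟨⟨hnm, hb⟩, hl⟩ := hm
    have hl' : ∀ k, n ≤ k → k < m → ¬ bp k = true := by
      intro k h1 h2 h3
      have h4 : m ≤ k := hl ⟨h1, h3⟩
      omega
    clear hl
    induction hnm using Nat.decreasingInduction with
    | self => rw [ho, if_pos hb]
    | of_succ k hk ih =>
      rw [ho, if_neg (hl' k le_rfl hk)]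
      exact ih (fun j h1 h2 => hl' j (by omega) h2)
  have hleast : ∀ n, ∃ m, IsLeast {k : ℕ | n ≤ k ∧ bp k = true} m := fun n =>
    ⟨Nat.find (hbp n), Nat.find_spec (hbp n), fun k hk => Nat.find_min' (hbp n) hk⟩
  choose f hf using hleast
  refine ⟨⟨fun n => i (f n), ?_, ?_⟩, key⟩
  · intro n
    by_cases h : bp n = true
    · have h1 : f n ≤ n := (hf n).2 ⟨le_rfl, h⟩
      have h2 : n ≤ f n := (hf n).1.1
      simp only [if_pos h]
      rw [le_antisymm h1 h2]
    · simp only [if_neg h]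
      have h2 : n ≤ f n := (hf n).1.1
      have h3 : n ≠ f n := fun e => h (by rw [e]; exact (hf n).1.2)
      have h4 : f (n + 1) ≤ f n := (hf (n + 1)).2 ⟨by omega, (hf n).1.2⟩
      have h5 : n + 1 ≤ f (n + 1) := (hf (n + 1)).1.1
      have h6 : f n ≤ f (n + 1) := (hf n).2 ⟨by omega, (hf (n + 1)).1.2⟩
      rw [le_antisymm h6 h4]
  · intro o ho
    funext n
    exact key o ho n (f n) (hf n)
end

section
/- Let T be a type with two distinct elements, let i : ℕ → T, and let bp : ℕ → Bool be such that there exists N with bp m = false for all m ≥ N. Then there exist two distinct functions o, o' : ℕ → T both satisfying, for every n, o n = (if bp n = true then i n else o (n + 1)) (respectively for o'). -/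
theorem backfill_aux {T : Type*} (c : T) (N : ℕ) : ∀ (i : ℕ → T) (bp : ℕ → Bool),
    (∀ m : ℕ, N ≤ m → bp m = false) →
    ∃ o : ℕ → T, o N = c ∧ ∀ n : ℕ, o n = if bp n = true then i n else o (n + 1) := by
  induction N with
  | zero =>
    intro i bp h
    exact ⟨fun _ => c, rfl, fun n => by simp [h n (Nat.zero_le n)]⟩
  | succ N ih =>
    intro i bp h
    obtain ⟨o, hN, ho⟩ := ih (fun n => i (n + 1)) (fun n => bp (n + 1))
      (fun m hm => h (m + 1) (by omega))
    refine ⟨fun n => Nat.casesOn n (if bp 0 = true then i 0 else o 0) o, hN, ?_⟩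
    intro n
    cases n with
    | zero => rfl
    | succ n => exact ho n

/-- If `T` has two distinct elements and `bp` is false from some point `N`
on, then the backfill equation `o n = if bp n then i n else o (n+1)` admits two distinct
solutions. -/
theorem stmt16 {T : Type*} (a b : T) (hab : a ≠ b) (i : ℕ → T) (bp : ℕ → Bool)
    (N : ℕ) (hbp : ∀ m : ℕ, N ≤ m → bp m = false) :
    ∃ o o' : ℕ → T, o ≠ o' ∧
      (∀ n : ℕ, o n = if bp n = true then i n else o (n + 1)) ∧
      (∀ n : ℕ, o' n = if bp n = true then i n else o' (n + 1)) := by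
  obtain ⟨o, hN, ho⟩ := backfill_aux a N i bp hbp
  obtain ⟨p, hpN, hp⟩ := backfill_aux b N i bp hbp
  refine ⟨o, p, ?_, ho, hp⟩
  intro h
  exact hab (by rw [← hN, ← hpN, h])
end
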